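/- arXiv:2203.09321 — 3 statements merged into one kernel-verified Lean document; each statement's English description precedes it below -/
import Mathlib

section
/- For all closed terms P, Q over Σ_CP(A): CP ⊢ P = Q if and only if bf(P) = bf(Q). -/
/-- Closed terms over Σ_CP(A). -/
inductive CTerm (A : Type) : Type
  | T : CTerm A
  | F : CTerm A
  | at_ : A → CTerm A
  | cond : CTerm A → CTerm A → CTerm A → CTerm A

/-- CP-derivability: the smallest congruence containing (CP1)–(CP4). -/
inductive CP {A : Type} : CTerm A → CTerm A → Prop
  | refl (p : CTerm A) : CP p p
  | symm {p q : CTerm A} : CP p q → CP q p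
  | trans {p q r : CTerm A} : CP p q → CP q r → CP p r
  | congr {p p' q q' r r' : CTerm A} : CP p p' → CP q q' → CP r r' →
      CP (CTerm.cond p q r) (CTerm.cond p' q' r')
  | cp1 (x y : CTerm A) : CP (CTerm.cond x CTerm.T y) x
  | cp2 (x y : CTerm A) : CP (CTerm.cond x CTerm.F y) y
  | cp3 (x : CTerm A) : CP (CTerm.cond CTerm.T x CTerm.F) x
  | cp4 (x y z u v : CTerm A) :
      CP (CTerm.cond x (CTerm.cond y z u) v)
         (CTerm.cond (CTerm.cond x y v) z (CTerm.cond x u v))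

/-- The substitution P[T↦Q, F↦R] (defined on basic forms; extended trivially elsewhere). -/
def subst {A : Type} (Q R : CTerm A) : CTerm A → CTerm A
  | CTerm.T => Q
  | CTerm.F => R
  | CTerm.at_ a => CTerm.at_ a
  | CTerm.cond p1 c p2 => CTerm.cond (subst Q R p1) c (subst Q R p2)

/-- The basic form function bf. -/
def bf {A : Type} : CTerm A → CTerm A
  | CTerm.T => CTerm.T
  | CTerm.F => CTerm.F
  | CTerm.at_ a => CTerm.cond CTerm.T (CTerm.at_ a) CTerm.F
  | CTerm.cond p q r => subst (bf p) (bf r) (bf q)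

/-- Basic forms: binary trees with leaves `T`, `F` and inner nodes labelled by atoms. -/
inductive IsBasic {A : Type} : CTerm A → Prop
  | T : IsBasic CTerm.T
  | F : IsBasic CTerm.F
  | cond {p q : CTerm A} (a : A) : IsBasic p → IsBasic q →
      IsBasic (CTerm.cond p (CTerm.at_ a) q)

theorem isBasic_subst {A : Type} {p q r : CTerm A} (hp : IsBasic p) (hq : IsBasic q)
    (hr : IsBasic r) : IsBasic (subst q r p) := by
  induction hp with
  | T => exact hq
  | F => exact hr
  | cond a _ _ ih₁ ih₂ => exact .cond a ih₁ ih₂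

theorem isBasic_bf {A : Type} (p : CTerm A) : IsBasic (bf p) := by
  induction p with
  | T => exact .T
  | F => exact .F
  | at_ a => exact .cond a .T .F
  | cond p q r ihp ihq ihr => exact isBasic_subst ihq ihp ihr

theorem subst_T_F {A : Type} (p : CTerm A) : subst CTerm.T CTerm.F p = p := by
  induction p with
  | T | F | at_ a => rfl
  | cond p q r ihp _ ihr => simp only [subst, ihp, ihr]

theorem subst_subst {A : Type} (x v y u z : CTerm A) :
    subst x v (subst y u z) = subst (subst x v y) (subst x v u) z := by
  induction z with
  | T | F | at_ a => rfl
  | cond p q r ihp _ ihr => simp only [subst, ihp, ihr]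

/-- On basic forms, substitution is provably equal to the conditional. -/
theorem IsBasic.cp_cond_subst {A : Type} {p : CTerm A} (hp : IsBasic p) (q r : CTerm A) :
    CP (CTerm.cond q p r) (subst q r p) := by
  induction hp with
  | T => exact .cp1 q r
  | F => exact .cp2 q r
  | cond a _ _ ih₁ ih₂ => exact (CP.cp4 ..).trans (.congr ih₁ (.refl _) ih₂)

theorem cp_bf {A : Type} (p : CTerm A) : CP p (bf p) := by
  induction p with
  | T | F => exact .refl _
  | at_ a => exact (CP.cp3 _).symm
  | cond p q r ihp ihq ihr =>
    exact (CP.congr ihp ihq ihr).trans ((isBasic_bf q).cp_cond_subst _ _)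

theorem CP.bf_eq {A : Type} {p q : CTerm A} (h : CP p q) : bf p = bf q := by
  induction h with
  | refl => rfl
  | symm _ ih => exact ih.symm
  | trans _ _ ih₁ ih₂ => exact ih₁.trans ih₂
  | congr _ _ _ ih₁ ih₂ ih₃ => simp only [bf, ih₁, ih₂, ih₃]
  | cp1 | cp2 => rfl
  | cp3 x => exact subst_T_F _
  | cp4 => exact subst_subst ..

/-- CP ⊢ P = Q if and only if bf(P) = bf(Q). -/
theorem cp_iff_bf_eq {A : Type} (P Q : CTerm A) :
    CP P Q ↔ bf P = bf Q := by
  exact ⟨CP.bf_eq, fun h => (cp_bf P).trans (h ▸ (cp_bf Q).symm)⟩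
end

section
/- For all closed terms P, Q over Σ_CP(A): CPmem ⊢ P = Q if and only if mbf(P) = mbf(Q). -/
/-- CPmem-derivability: the smallest congruence containing (CP1)–(CP4) and (CPmem). -/
inductive CPmem {A : Type} : CTerm A → CTerm A → Prop
  | refl (p : CTerm A) : CPmem p p
  | symm {p q : CTerm A} : CPmem p q → CPmem q p
  | trans {p q r : CTerm A} : CPmem p q → CPmem q r → CPmem p r
  | congr {p p' q q' r r' : CTerm A} : CPmem p p' → CPmem q q' → CPmem r r' →
      CPmem (CTerm.cond p q r) (CTerm.cond p' q' r')
  | cp1 (x y : CTerm A) : CPmem (CTerm.cond x CTerm.T y) x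
  | cp2 (x y : CTerm A) : CPmem (CTerm.cond x CTerm.F y) y
  | cp3 (x : CTerm A) : CPmem (CTerm.cond CTerm.T x CTerm.F) x
  | cp4 (x y z u v : CTerm A) :
      CPmem (CTerm.cond x (CTerm.cond y z u) v)
            (CTerm.cond (CTerm.cond x y v) z (CTerm.cond x u v))
  | cpmem (x y z u v w : CTerm A) :
      CPmem (CTerm.cond x y (CTerm.cond z u (CTerm.cond v y w)))
            (CTerm.cond x y (CTerm.cond z u w))

/-- Occurrence of an atom in a term. -/
def occurs {A : Type} (a : A) : CTerm A → Prop
  | CTerm.T => False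
  | CTerm.F => False
  | CTerm.at_ b => b = a
  | CTerm.cond p q r => occurs a p ∨ occurs a q ∨ occurs a r

/-- Mem-basic forms over A. -/
inductive IsMemBasic {A : Type} : CTerm A → Prop
  | T : IsMemBasic CTerm.T
  | F : IsMemBasic CTerm.F
  | cond {p q : CTerm A} (a : A) : IsMemBasic p → IsMemBasic q →
      ¬ occurs a p → ¬ occurs a q →
      IsMemBasic (CTerm.cond p (CTerm.at_ a) q)

/-- Left-a-reduction ℓ_a (defined on basic forms; extended trivially elsewhere). -/
def la {A : Type} [DecidableEq A] (a : A) : CTerm A → CTerm A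
  | CTerm.T => CTerm.T
  | CTerm.F => CTerm.F
  | CTerm.at_ b => CTerm.at_ b
  | CTerm.cond p (CTerm.at_ b) q =>
      if b = a then la a p else CTerm.cond (la a p) (CTerm.at_ b) (la a q)
  | CTerm.cond p c q => CTerm.cond (la a p) c (la a q)

/-- Right-a-reduction r_a (defined on basic forms; extended trivially elsewhere). -/
def ra {A : Type} [DecidableEq A] (a : A) : CTerm A → CTerm A
  | CTerm.T => CTerm.T
  | CTerm.F => CTerm.F
  | CTerm.at_ b => CTerm.at_ b
  | CTerm.cond p (CTerm.at_ b) q =>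
      if b = a then ra a q else CTerm.cond (ra a p) (CTerm.at_ b) (ra a q)
  | CTerm.cond p c q => CTerm.cond (ra a p) c (ra a q)

/-- Size of a term (used for termination of `mf`). -/
def sz {A : Type} : CTerm A → Nat
  | CTerm.T => 1
  | CTerm.F => 1
  | CTerm.at_ _ => 1
  | CTerm.cond p q r => sz p + sz q + sz r + 1

theorem la_sz {A : Type} [DecidableEq A] (a : A) (p : CTerm A) : sz (la a p) ≤ sz p := by
  induction p with
  | T => simp [la, sz]
  | F => simp [la, sz]
  | at_ b => simp [la, sz]
  | cond p c q ihp ihc ihq =>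
      cases c with
      | at_ b =>
          simp only [la]
          split
          · simp only [sz]; omega
          · simp only [sz]; omega
      | T => simp only [la, sz]; omega
      | F => simp only [la, sz]; omega
      | cond c1 c2 c3 => simp only [la, sz]; omega

theorem ra_sz {A : Type} [DecidableEq A] (a : A) (p : CTerm A) : sz (ra a p) ≤ sz p := by
  induction p with
  | T => simp [ra, sz]
  | F => simp [ra, sz]
  | at_ b => simp [ra, sz]
  | cond p c q ihp ihc ihq =>
      cases c with
      | at_ b =>
          simp only [ra]
          split
          · simp only [sz]; omega
          · simp only [sz]; omega
      | T => simp only [ra, sz]; omega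
      | F => simp only [ra, sz]; omega
      | cond c1 c2 c3 => simp only [ra, sz]; omega

/-- The function mf (defined on basic forms; extended trivially elsewhere). -/
def mf {A : Type} [DecidableEq A] : CTerm A → CTerm A
  | CTerm.T => CTerm.T
  | CTerm.F => CTerm.F
  | CTerm.at_ b => CTerm.at_ b
  | CTerm.cond p (CTerm.at_ a) q =>
      CTerm.cond (mf (la a p)) (CTerm.at_ a) (mf (ra a q))
  | CTerm.cond p c q => CTerm.cond (mf p) c (mf q)
termination_by t => sz t
decreasing_by
  all_goals simp only [sz]
  all_goals try omega
  all_goals first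
    | exact lt_of_le_of_lt (la_sz _ _) (by omega)
    | exact lt_of_le_of_lt (ra_sz _ _) (by omega)

/-- The mem-basic form function. -/
def mbf {A : Type} [DecidableEq A] (P : CTerm A) : CTerm A := mf (bf P)

section

open CTerm (T F at_)

variable {A : Type}

/-- Basic forms over `A`. -/
inductive IsBasic_s9 : CTerm A → Prop
  | T : IsBasic_s9 T
  | F : IsBasic_s9 F
  | cond {p q : CTerm A} (a : A) : IsBasic_s9 p → IsBasic_s9 q → IsBasic_s9 (.cond p (at_ a) q)

theorem IsBasic_s9.subst {P Q R : CTerm A} (hP : IsBasic_s9 P) (hQ : IsBasic_s9 Q) (hR : IsBasic_s9 R) :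
    IsBasic_s9 (subst Q R P) := by
  induction hP with
  | T => exact hQ
  | F => exact hR
  | cond a _ _ ihp ihq => exact .cond a ihp ihq

theorem isBasic_bf_s9 (P : CTerm A) : IsBasic_s9 (bf P) := by
  induction P with
  | T => exact .T
  | F => exact .F
  | at_ a => exact .cond a .T .F
  | cond p q r ihp ihq ihr => exact ihq.subst ihp ihr

namespace CPmem

instance : Trans (CPmem (A := A)) CPmem CPmem := ⟨CPmem.trans⟩

theorem congr_left {p p' : CTerm A} (h : CPmem p p') (q r : CTerm A) :
    CPmem (.cond p q r) (.cond p' q r) :=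
  .congr h (.refl q) (.refl r)

theorem congr_right (p q : CTerm A) {r r' : CTerm A} (h : CPmem r r') :
    CPmem (.cond p q r) (.cond p q r') :=
  .congr (.refl p) (.refl q) h

theorem cond_subst (Q R : CTerm A) {P : CTerm A} (hP : IsBasic_s9 P) :
    CPmem (.cond Q P R) (subst Q R P) := by
  induction hP with
  | T => exact .cp1 Q R
  | F => exact .cp2 Q R
  | cond a _ _ ihp ihq => exact (cp4 ..).trans (.congr ihp (.refl _) ihq)

theorem self_bf (P : CTerm A) : CPmem P (bf P) := by
  induction P with
  | T => exact .refl _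
  | F => exact .refl _
  | at_ a => exact (cp3 _).symm
  | cond p q r ihp ihq ihr => exact (CPmem.congr ihp ihq ihr).trans (cond_subst _ _ (isBasic_bf_s9 q))

theorem cond_neg (x y z : CTerm A) : CPmem (.cond x (.cond F y T) z) (.cond z y x) :=
  (cp4 ..).trans (.congr (.cp2 ..) (.refl y) (.cp1 ..))

theorem contract_right (x y v w : CTerm A) :
    CPmem (.cond x y (.cond v y w)) (.cond x y w) := calc
  CPmem _ (.cond x y (.cond T F (.cond v y w))) := congr_right _ _ (cp2 ..).symm
  CPmem _ (.cond x y (.cond T F w)) := cpmem ..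
  CPmem _ _ := congr_right _ _ (cp2 ..)

theorem mem_right_left (x y z u v w : CTerm A) :
    CPmem (.cond x y (.cond (.cond v y w) u z)) (.cond x y (.cond w u z)) := calc
  CPmem _ (.cond x y (.cond z (.cond F u T) (.cond v y w))) := congr_right _ _ (cond_neg ..).symm
  CPmem _ (.cond x y (.cond z (.cond F u T) w)) := cpmem ..
  CPmem _ _ := congr_right _ _ (cond_neg ..)

/-- Rewriting terms that are only reached after `y` evaluated to false. -/
theorem mem_right_congr (x y u : CTerm A) {z z' w w' : CTerm A}
    (hz : ∀ v, CPmem (.cond v y z) (.cond v y z')) (hw : ∀ v, CPmem (.cond v y w) (.cond v y w')) :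
    CPmem (.cond x y (.cond z u w)) (.cond x y (.cond z' u w')) := calc
  CPmem _ (.cond x y (.cond z u (.cond T y w))) := (cpmem ..).symm
  CPmem _ (.cond x y (.cond z u (.cond T y w'))) := congr_right _ _ (congr_right _ _ (hw T))
  CPmem _ (.cond x y (.cond z u w')) := cpmem ..
  CPmem _ (.cond x y (.cond (.cond T y z) u w')) := (mem_right_left ..).symm
  CPmem _ (.cond x y (.cond (.cond T y z') u w')) := congr_right _ _ (congr_left (hz T) _ _)
  CPmem _ _ := mem_right_left ..

/-- Rewriting terms that are only reached after `y` evaluated to true. -/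
theorem mem_left_congr (x y u : CTerm A) {z z' w w' : CTerm A}
    (hz : ∀ v, CPmem (.cond z y v) (.cond z' y v)) (hw : ∀ v, CPmem (.cond w y v) (.cond w' y v)) :
    CPmem (.cond (.cond z u w) y x) (.cond (.cond z' u w') y x) :=
  (cond_neg ..).symm.trans <| (mem_right_congr x (.cond F y T) u
    (fun v => (cond_neg ..).trans ((hz v).trans (cond_neg ..).symm))
    (fun v => (cond_neg ..).trans ((hw v).trans (cond_neg ..).symm))).trans (cond_neg ..)

theorem contract_left (x y v w : CTerm A) :
    CPmem (.cond (.cond w y v) y x) (.cond w y x) := calc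
  CPmem _ (.cond x (.cond F y T) (.cond w y v)) := (cond_neg ..).symm
  CPmem _ (.cond x (.cond F y T) (.cond v (.cond F y T) w)) := congr_right _ _ (cond_neg ..).symm
  CPmem _ (.cond x (.cond F y T) w) := contract_right ..
  CPmem _ _ := cond_neg ..

theorem cond_ra [DecidableEq A] (a : A) (q x : CTerm A) :
    CPmem (.cond x (at_ a) q) (.cond x (at_ a) (ra a q)) := by
  fun_induction ra a q generalizing x with
  | case1 | case2 | case3 => exact .refl _
  | case4 p q ih => exact (contract_right ..).trans (ih x)
  | case5 p b q hb ihp ihq => exact mem_right_congr _ _ _ ihp ihq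
  | case6 p c q hc ihp ihq => exact mem_right_congr _ _ _ ihp ihq

theorem cond_la [DecidableEq A] (a : A) (p x : CTerm A) :
    CPmem (.cond p (at_ a) x) (.cond (la a p) (at_ a) x) := by
  fun_induction la a p generalizing x with
  | case1 | case2 | case3 => exact .refl _
  | case4 p q ih => exact (contract_left ..).trans (ih x)
  | case5 p b q hb ihp ihq => exact mem_left_congr _ _ _ ihp ihq
  | case6 p c q hc ihp ihq => exact mem_left_congr _ _ _ ihp ihq

theorem self_mf [DecidableEq A] (P : CTerm A) : CPmem P (mf P) := by
  fun_induction mf P with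
  | case1 | case2 | case3 => exact .refl _
  | case4 p a q ihp ihq =>
    exact (cond_la ..).trans ((cond_ra ..).trans (.congr ihp (.refl _) ihq))
  | case5 p c q hc ihp ihq => exact .congr ihp (.refl _) ihq

theorem self_mbf [DecidableEq A] (P : CTerm A) : CPmem P (mbf P) :=
  (self_bf P).trans (self_mf _)

end CPmem

section MemBasic

variable [DecidableEq A]

theorem IsBasic_s9.la {P : CTerm A} (hP : IsBasic_s9 P) (a : A) : IsBasic_s9 (la a P) := by
  induction hP with
  | T => exact .T
  | F => exact .F
  | cond b _ _ ihp ihq =>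
    rw [_root_.la]
    split
    · exact ihp
    · exact .cond b ihp ihq

theorem IsBasic_s9.ra {P : CTerm A} (hP : IsBasic_s9 P) (a : A) : IsBasic_s9 (ra a P) := by
  induction hP with
  | T => exact .T
  | F => exact .F
  | cond b _ _ ihp ihq =>
    rw [_root_.ra]
    split
    · exact ihq
    · exact .cond b ihp ihq

theorem IsBasic_s9.not_occurs_la {P : CTerm A} (hP : IsBasic_s9 P) (a : A) :
    ¬ occurs a (_root_.la a P) := by
  induction hP with
  | T | F => simp [_root_.la, occurs]
  | cond b _ _ ihp ihq =>
    rw [_root_.la]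
    split <;> simp_all [occurs]

theorem IsBasic_s9.not_occurs_ra {P : CTerm A} (hP : IsBasic_s9 P) (a : A) :
    ¬ occurs a (_root_.ra a P) := by
  induction hP with
  | T | F => simp [_root_.ra, occurs]
  | cond b _ _ ihp ihq =>
    rw [_root_.ra]
    split <;> simp_all [occurs]

theorem occurs_of_occurs_la {a b : A} {P : CTerm A} (h : occurs b (la a P)) : occurs b P := by
  fun_induction la a P with grind [occurs]

theorem occurs_of_occurs_ra {a b : A} {P : CTerm A} (h : occurs b (ra a P)) : occurs b P := by
  fun_induction ra a P with grind [occurs]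

theorem occurs_of_occurs_mf {b : A} {P : CTerm A} (h : occurs b (mf P)) : occurs b P := by
  fun_induction mf P with grind [occurs, occurs_of_occurs_la, occurs_of_occurs_ra]

theorem IsBasic_s9.isMemBasic_mf {P : CTerm A} (hP : IsBasic_s9 P) : IsMemBasic (mf P) := by
  fun_induction mf P with
  | case1 => exact .T
  | case2 => exact .F
  | case3 => nomatch hP
  | case4 p a q ihp ihq =>
    cases hP with
    | cond _ hp hq =>
      exact .cond a (ihp (hp.la a)) (ihq (hq.ra a))
        (fun h => hp.not_occurs_la a (occurs_of_occurs_mf h))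
        (fun h => hq.not_occurs_ra a (occurs_of_occurs_mf h))
  | case5 p c q hc ihp ihq =>
    cases hP with
    | cond a => exact absurd rfl (hc a)

theorem isMemBasic_mbf (P : CTerm A) : IsMemBasic (mbf P) :=
  (isBasic_bf_s9 P).isMemBasic_mf

end MemBasic

/-- The truth value of a term under a valuation of the atoms. -/
def eval (f : A → Bool) : CTerm A → Bool
  | T => true
  | F => false
  | at_ a => f a
  | .cond p q r => if eval f q then eval f p else eval f r

/-- The atoms queried by the short-circuit evaluation of a term, most recent first. -/
def queries (f : A → Bool) : CTerm A → List A
  | T => []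
  | F => []
  | at_ a => [a]
  | .cond p q r => (if eval f q then queries f p else queries f r) ++ queries f q

theorem mem_queries_occurs {f : A → Bool} {a : A} {P : CTerm A} (h : a ∈ queries f P) :
    occurs a P := by
  induction P with grind [queries, occurs]

theorem eval_congr {f g : A → Bool} {P : CTerm A} (h : ∀ a, occurs a P → f a = g a) :
    eval f P = eval g P := by
  induction P with grind [eval, occurs]

theorem queries_congr {f g : A → Bool} {P : CTerm A} (h : ∀ a, occurs a P → f a = g a) :
    queries f P = queries g P := by
  induction P with
  | T | F | at_ => rfl
  | cond p q r ihp ihq ihr =>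
    have := eval_congr (P := q) (f := f) (g := g) (by grind [occurs])
    grind [queries, occurs]

theorem IsMemBasic.nodup_queries {P : CTerm A} (hP : IsMemBasic P) (f : A → Bool) :
    (queries f P).Nodup := by
  induction hP with
  | T | F => exact List.nodup_nil
  | cond a _ _ hp hq ihp ihq =>
    have := mt (mem_queries_occurs (f := f)) hp
    have := mt (mem_queries_occurs (f := f)) hq
    simp only [queries]
    split <;> simp_all [List.nodup_append] <;> grind

section Semantics

variable [DecidableEq A]

/-- Two terms are memorizing equivalent if under every valuation they have the same truth value
and query the same atoms in the same order, disregarding repeated queries. -/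
def MemEquiv (P Q : CTerm A) : Prop :=
  ∀ f, eval f P = eval f Q ∧ (queries f P).dedup = (queries f Q).dedup

theorem List.dedup_append_congr {l l' m m' : List A} (hl : l.dedup = l'.dedup)
    (hm : m.dedup = m'.dedup) : (l ++ m).dedup = (l' ++ m').dedup := by
  have key (l m : List A) : (l ++ m).dedup = (l.dedup ++ m).dedup := by
    induction l with
    | nil => rfl
    | cons a l ih =>
      by_cases h : a ∈ l
      · simp [h, ih, List.dedup_cons_of_mem]
      · by_cases h' : a ∈ m
        · simp [h, h', ih, List.dedup_cons_of_mem, List.dedup_cons_of_notMem]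
        · simp [h, h', ih, List.dedup_cons_of_notMem]
  rw [key l, key l', hl, List.dedup_append, List.dedup_append _ m', hm]

theorem CPmem.memEquiv {P Q : CTerm A} (h : CPmem P Q) : MemEquiv P Q := by
  induction h with
  | refl => exact fun f => ⟨rfl, rfl⟩
  | symm _ ih => exact fun f => ⟨(ih f).1.symm, (ih f).2.symm⟩
  | trans _ _ ih₁ ih₂ => exact fun f => ⟨(ih₁ f).1.trans (ih₂ f).1, (ih₁ f).2.trans (ih₂ f).2⟩
  | @congr p p' q q' r r' _ _ _ ihp ihq ihr =>
    intro f
    simp only [eval, queries, (ihp f).1, (ihq f).1, (ihr f).1, true_and]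
    split
    · exact List.dedup_append_congr (ihp f).2 (ihq f).2
    · exact List.dedup_append_congr (ihr f).2 (ihq f).2
  | cp1 | cp2 => simp [MemEquiv, eval, queries]
  | cp3 x => intro f; simp [eval, queries]
  | cp4 x y z u v =>
    intro f
    cases hz : eval f z <;> simp [eval, queries, hz]
  | cpmem x y z u v w =>
    intro f
    cases hy : eval f y <;> cases hu : eval f u <;> simp [eval, queries, hy, hu]
    exact List.dedup_append_congr rfl (List.Subset.dedup_append_right (by simp))

theorem forall_of_forall_update {P Q : CTerm A} {a : A} {b : Bool} (hP : ¬ occurs a P)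
    (hQ : ¬ occurs a Q)
    (h : ∀ f, f a = b → eval f P = eval f Q ∧ queries f P = queries f Q) (f : A → Bool) :
    eval f P = eval f Q ∧ queries f P = queries f Q := by
  have agree {R : CTerm A} (hR : ¬ occurs a R) :
      ∀ c, occurs c R → f c = Function.update f a b c := by
    intro c hc
    rw [Function.update_of_ne]
    rintro rfl
    exact hR hc
  rw [eval_congr (agree hP), eval_congr (agree hQ), queries_congr (agree hP),
    queries_congr (agree hQ)]
  exact h _ (Function.update_self ..)

theorem IsMemBasic.eq_of_forall {P Q : CTerm A} (hP : IsMemBasic P) (hQ : IsMemBasic Q)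
    (h : ∀ f, eval f P = eval f Q ∧ queries f P = queries f Q) : P = Q := by
  induction hP generalizing Q with
  | T | F => cases hQ <;> simp_all [eval, queries]
  | @cond p q a _ _ hp hq ihp ihq =>
    cases hQ with
    | T | F => simp [queries] at h
    | @cond p' q' b hp₁ hq₁ hp' hq' =>
      have hab : a = b := by
        have := (h fun _ => true).2
        simp only [queries] at this
        simpa using (List.append_inj' this rfl).2
      subst hab
      rw [ihp hp₁ (forall_of_forall_update (b := true) hp hp' fun f hf => ?_),
        ihq hq₁ (forall_of_forall_update (b := false) hq hq' fun f hf => ?_)]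
      all_goals simpa [eval, queries, hf] using h f

theorem IsMemBasic.eq_of_memEquiv {P Q : CTerm A} (hP : IsMemBasic P) (hQ : IsMemBasic Q)
    (h : MemEquiv P Q) : P = Q :=
  hP.eq_of_forall hQ fun f => ⟨(h f).1, by
    simpa only [(hP.nodup_queries f).dedup, (hQ.nodup_queries f).dedup] using (h f).2⟩

end Semantics

end

/-- CPmem ⊢ P = Q if and only if mbf(P) = mbf(Q). -/
theorem cpmem_iff_mbf_eq {A : Type} [DecidableEq A] (P Q : CTerm A) :
    CPmem P Q ↔ mbf P = mbf Q := by
  refine ⟨fun h => ?_, fun h => ?_⟩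
  · exact (isMemBasic_mbf P).eq_of_memEquiv (isMemBasic_mbf Q)
      ((CPmem.self_mbf P).symm.trans (h.trans (CPmem.self_mbf Q))).memEquiv
  · exact (CPmem.self_mbf P).trans (h ▸ (CPmem.self_mbf Q).symm)
end

section
/- Every axiom of EqMSCLℓI is derivable from EqMSCL together with the defining equation x ↔❛ y = (x ∧❛ y) ∨❛ (¬x ∧❛ ¬y). -/
/-- Terms over Σ_SCLℓI(A): variables, T, F, ¬, ∧❛, ∨❛, ↔❛. -/
inductive ITerm : Type
  | var : Nat → ITerm
  | T : ITerm
  | F : ITerm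
  | neg : ITerm → ITerm
  | and : ITerm → ITerm → ITerm
  | or : ITerm → ITerm → ITerm
  | iff : ITerm → ITerm → ITerm

/-- Derivability from EqMSCL together with the defining equation
x ↔❛ y = (x ∧❛ y) ∨❛ (¬x ∧❛ ¬y) (axioms taken as schemes). -/
inductive DerivM : ITerm → ITerm → Prop
  | refl (p : ITerm) : DerivM p p
  | symm {p q : ITerm} : DerivM p q → DerivM q p
  | trans {p q r : ITerm} : DerivM p q → DerivM q r → DerivM p r
  | congr_neg {p p' : ITerm} : DerivM p p' → DerivM (ITerm.neg p) (ITerm.neg p')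
  | congr_and {p p' q q' : ITerm} : DerivM p p' → DerivM q q' →
      DerivM (ITerm.and p q) (ITerm.and p' q')
  | congr_or {p p' q q' : ITerm} : DerivM p p' → DerivM q q' →
      DerivM (ITerm.or p q) (ITerm.or p' q')
  | congr_iff {p p' q q' : ITerm} : DerivM p p' → DerivM q q' →
      DerivM (ITerm.iff p q) (ITerm.iff p' q')
  | ax_neg : DerivM ITerm.F (ITerm.neg ITerm.T)
  | ax_or (x y : ITerm) :
      DerivM (ITerm.or x y) (ITerm.neg (ITerm.and (ITerm.neg x) (ITerm.neg y)))
  | ax_tand (x : ITerm) : DerivM (ITerm.and ITerm.T x) x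
  | ax_abs (x y : ITerm) : DerivM (ITerm.and x (ITerm.or x y)) x
  | ax_mem (x y z : ITerm) :
      DerivM (ITerm.and (ITerm.or x y) z)
             (ITerm.or (ITerm.and (ITerm.neg x) (ITerm.and y z)) (ITerm.and x z))
  | ax_iffdef (x y : ITerm) :
      DerivM (ITerm.iff x y)
             (ITerm.or (ITerm.and x y) (ITerm.and (ITerm.neg x) (ITerm.neg y)))

/-- An algebra satisfying the equations of EqMSCL. -/
class MSCLAlgebra (α : Type*) where
  tt : α
  ff : α
  neg : α → α
  and : α → α → α
  or : α → α → α
  ff_eq : ff = neg tt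
  or_eq (x y : α) : or x y = neg (and (neg x) (neg y))
  tt_and (x : α) : and tt x = x
  and_or_self (x y : α) : and x (or x y) = x
  or_and (x y z : α) : and (or x y) z = or (and (neg x) (and y z)) (and x z)

namespace MSCLAlgebra

local infixl:70 " ⋏ " => MSCLAlgebra.and
local infixl:65 " ⋎ " => MSCLAlgebra.or
local prefix:max "∼" => MSCLAlgebra.neg

variable {α : Type*} [MSCLAlgebra α] (x y z : α)

theorem tt_or : tt ⋎ x = tt := by
  rw [← tt_and (tt ⋎ x), and_or_self]

theorem neg_ff_and_neg : ∼(ff ⋏ ∼x) = tt := by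
  rw [ff_eq, ← or_eq, tt_or]

theorem neg_ff : ∼(ff : α) = tt := by
  have h := neg_ff_and_neg (∼(ff : α) ⋏ ∼tt)
  rwa [← or_eq, and_or_self] at h

theorem neg_neg : ∼∼x = x := by
  have h (y : α) : (ff ⋏ y) ⋎ y = y := by
    have := or_and tt tt y
    rw [tt_or, tt_and, ← ff_eq] at this
    exact this.symm
  have triple (y : α) : ∼∼∼y = ∼y := by
    have := h (∼y)
    rwa [or_eq, neg_ff_and_neg, tt_and] at this
  rw [← h x, or_eq, triple]

theorem neg_tt : ∼(tt : α) = ff := ff_eq.symm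

theorem neg_and : ∼(x ⋏ y) = ∼x ⋎ ∼y := by
  rw [or_eq, neg_neg, neg_neg]

theorem neg_or : ∼(x ⋎ y) = ∼x ⋏ ∼y := by
  rw [or_eq, neg_neg]

theorem ff_or : ff ⋎ x = x := by
  rw [or_eq, neg_ff, tt_and, neg_neg]

theorem ff_and : ff ⋏ x = ff := by
  simpa only [neg_or, neg_neg, neg_tt] using congrArg neg (tt_or (∼x))

theorem or_ff : x ⋎ ff = x := by
  have h := or_and ff tt x
  rw [ff_or, tt_and, neg_ff, tt_and, ff_and] at h
  exact h.symm

theorem and_tt : x ⋏ tt = x := by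
  rw [← neg_neg (x ⋏ tt), neg_and, neg_tt, or_ff, neg_neg]

theorem and_self : x ⋏ x = x := by
  simpa only [or_ff] using and_or_self x ff

theorem or_self : x ⋎ x = x := by
  rw [or_eq, and_self, neg_neg]

theorem or_and_self : x ⋎ x ⋏ y = x := by
  simpa only [neg_and, neg_or, neg_neg] using congrArg neg (and_or_self (∼x) (∼y))

theorem and_or : x ⋏ y ⋎ z = (∼x ⋎ (y ⋎ z)) ⋏ (x ⋎ z) := by
  simpa only [neg_and, neg_or, neg_neg] using congrArg neg (or_and (∼x) (∼y) (∼z))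

theorem neg_or_and : (∼x ⋎ y) ⋏ z = x ⋏ (y ⋏ z) ⋎ ∼x ⋏ z := by
  rw [or_and, neg_neg]

theorem neg_and_or_self : ∼x ⋏ y ⋎ x = x ⋎ y := by
  simpa only [and_tt] using (or_and x y tt).symm

theorem neg_or_and_self : (∼x ⋎ y) ⋏ x = x ⋏ y := by
  simpa only [or_ff] using (and_or x y ff).symm

theorem and_neg_self : x ⋏ ∼x = x ⋏ ff := by
  rw [← neg_or_and_self, or_self, ← neg_or_and_self x ff, or_ff]

theorem neg_and_self : ∼x ⋏ x = x ⋏ ff := by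
  rw [← neg_or_and_self x ff, or_ff]

theorem neg_and_ff : ∼x ⋏ ff = x ⋏ ff := by
  rw [← and_neg_self, neg_neg, neg_and_self]

theorem or_neg_self : x ⋎ ∼x = x ⋎ tt := by
  simpa only [neg_and, neg_neg, neg_ff] using
    congrArg neg (and_neg_self (∼x))

theorem and_ff_or_and : x ⋏ ff ⋎ x ⋏ y = x ⋏ y := by
  simpa only [or_ff, ff_and, neg_and_ff] using (or_and x ff y).symm

theorem or_tt_and_or : (x ⋎ tt) ⋏ (x ⋎ y) = x ⋎ y := by
  simpa only [neg_and, neg_or, neg_neg, neg_ff] using congrArg neg (and_ff_or_and (∼x) (∼y))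

theorem or_tt_and_ff : (x ⋎ tt) ⋏ ff = x ⋏ ff := by
  rw [or_and, tt_and, neg_and_ff, or_self]

theorem and_ff_or_tt : x ⋏ ff ⋎ tt = x ⋎ tt := by
  simpa only [neg_and, neg_or, neg_neg, neg_ff, neg_tt] using congrArg neg (or_tt_and_ff (∼x))

theorem neg_or_tt : ∼x ⋎ tt = x ⋎ tt := by
  simpa only [neg_and, neg_neg, neg_ff] using congrArg neg (neg_and_ff (∼x))

theorem neg_and_ff_eq_or_tt : ∼(x ⋏ ff) = x ⋎ tt := by
  rw [neg_and, neg_ff, neg_or_tt]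

/-- `x ⋏ ff` is a left zero for `⋏`. -/
theorem and_ff_and : x ⋏ ff ⋏ y = x ⋏ ff := by
  have h : x ⋏ ff ⋏ ff = x ⋏ ff := by
    rw [← neg_and_ff (x ⋏ ff), neg_and_ff_eq_or_tt, or_tt_and_ff]
  rw [← and_ff_or_and (x ⋏ ff) y, h, or_and_self]

theorem or_and_or : x ⋎ y ⋏ (x ⋎ z) = (x ⋎ y) ⋏ (x ⋎ z) := by
  rw [or_and x y (x ⋎ z), and_or_self, neg_and_or_self]

theorem or_or_self_left : x ⋎ (x ⋎ y) = x ⋎ y := by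
  simpa only [tt_and, or_tt_and_or] using or_and_or x tt y

theorem and_and_self_left : x ⋏ (x ⋏ y) = x ⋏ y := by
  simpa only [neg_or, neg_neg] using congrArg neg (or_or_self_left (∼x) (∼y))

theorem or_neg_and : x ⋎ ∼x ⋏ y = x ⋎ y := by
  rw [← neg_and_or_self, and_and_self_left, neg_and_or_self]

theorem and_neg_or : x ⋏ (∼x ⋎ y) = x ⋏ y := by
  simpa only [neg_and, neg_or, neg_neg] using congrArg neg (or_neg_and (∼x) (∼y))

theorem and_neg_and : x ⋏ (∼x ⋏ y) = x ⋏ ff := by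
  rw [← and_neg_or, or_and_self, and_neg_self]

theorem or_neg_or : x ⋎ (∼x ⋎ y) = x ⋎ tt := by
  simpa only [neg_and, neg_neg, neg_ff] using congrArg neg (and_neg_and (∼x) (∼y))

theorem and_or_and : x ⋏ y ⋎ x ⋏ z = x ⋏ (y ⋎ x ⋏ z) := by
  rw [and_or x y (x ⋏ z), or_and_self, neg_or_and_self]

theorem and_or_and_ff : x ⋏ y ⋎ x ⋏ ff = x ⋏ y := by
  have h : (x ⋎ tt) ⋏ (x ⋏ y) = x ⋏ y := by
    rw [← and_ff_or_and x y, ← and_ff_or_tt, or_tt_and_or]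
  have hneg : ∼(x ⋎ tt) = x ⋏ ff := by
    rw [← neg_and_ff_eq_or_tt, neg_neg]
  have key := neg_or_and (x ⋎ tt) x y
  rw [h, hneg, and_ff_and, ← neg_and_ff, neg_and_or_self, or_ff, neg_and_ff] at key
  exact key.symm

theorem and_and_self_right : x ⋏ (y ⋏ x) = x ⋏ y := by
  rw [← and_or_and_ff x (y ⋏ x), ← neg_and_self, ← neg_or_and, neg_or_and_self]

theorem or_or_self_right : x ⋎ (y ⋎ x) = x ⋎ y := by
  simpa only [neg_and, neg_neg] using
    congrArg neg (and_and_self_right (∼x) (∼y))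

theorem and_and_self : x ⋏ y ⋏ x = x ⋏ y := by
  rw [← and_and_self_right, and_and_self_left, and_self]

theorem or_and_or_cancel : x ⋎ (x ⋏ y ⋎ z) = x ⋎ z := by
  have h := or_and x (∼x ⋎ (y ⋎ z)) (x ⋎ z)
  rw [or_neg_or, or_tt_and_or, ← and_or, and_or_self, neg_and_or_self] at h
  exact h.symm

theorem and_neg_and_or : x ⋏ (∼x ⋏ y ⋎ z) = x ⋏ z := by
  rw [← neg_or_and_self, or_and_or_cancel, neg_or_and_self]

theorem and_or_neg_and : x ⋏ (y ⋎ ∼x ⋏ z) = x ⋏ y := by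
  rw [← and_neg_and_or x z, or_or_self_right, and_neg_and_or]

theorem and_neg_or_and : x ⋏ ((∼x ⋎ y) ⋏ z) = x ⋏ (y ⋏ z) := by
  rw [neg_or_and, and_or_neg_and, and_and_self_left]

theorem and_or_self_and : x ⋏ ((x ⋎ y) ⋏ z) = x ⋏ z := by
  rw [or_and, and_neg_and_or, and_and_self_left]

theorem and_and_and_left : x ⋏ y ⋏ (x ⋏ z) = x ⋏ y ⋏ z := by
  have h : ∼(x ⋏ y) ⋎ x = x ⋏ y ⋎ tt := by
    rw [← neg_and_or_self, neg_neg, and_and_self, or_neg_self]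
  rw [← and_neg_or_and (x ⋏ y) x z, h, and_or_self_and]

theorem or_or_or_left : x ⋎ y ⋎ (x ⋎ z) = x ⋎ y ⋎ z := by
  simpa only [neg_and, neg_neg] using congrArg neg (and_and_and_left (∼x) (∼y) (∼z))

theorem and_self_and_and : x ⋏ (y ⋏ (x ⋏ z)) = x ⋏ (y ⋏ z) := by
  have h (w : α) : x ⋏ (x ⋏ y ⋏ w) = x ⋏ (y ⋏ w) := by
    rw [← and_neg_or_and x (x ⋏ y), ← and_neg_or_and x y]
    congr 2
    simpa only [neg_neg] using or_neg_and (∼x) y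
  rw [← h, and_and_and_left, h]

theorem or_and_ff_and_neg_and : (x ⋎ y ⋏ ff) ⋏ (∼y ⋏ z) = (x ⋎ y) ⋏ (∼y ⋏ z) := by
  rw [or_and, or_and, and_ff_and, and_neg_and]

theorem and_assoc : x ⋏ y ⋏ z = x ⋏ (y ⋏ z) :=
  calc x ⋏ y ⋏ z
    _ = x ⋏ y ⋏ (x ⋏ z) := (and_and_and_left x y z).symm
    _ = (x ⋏ y ⋎ ∼x ⋏ ff) ⋏ (x ⋏ z) := by rw [neg_and_ff, and_or_and_ff]
    _ = (x ⋏ y ⋎ ∼x) ⋏ (x ⋏ z) := by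
      simpa only [neg_neg] using or_and_ff_and_neg_and (x ⋏ y) (∼x) z
    _ = (∼x ⋎ y) ⋏ (x ⋏ z) := by
      congr 1
      simpa only [neg_neg] using neg_and_or_self (∼x) y
    _ = x ⋏ (y ⋏ z) ⋎ x ⋏ ff := by
      rw [neg_or_and, and_self_and_and, ← neg_and_ff]
      congr 1
      simpa only [neg_neg] using and_neg_and (∼x) z
    _ = x ⋏ (y ⋏ z) := and_or_and_ff x (y ⋏ z)

theorem or_assoc : x ⋎ y ⋎ z = x ⋎ (y ⋎ z) := by
  simpa only [neg_and, neg_neg] using congrArg neg (and_assoc (∼x) (∼y) (∼z))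

theorem and_or_distrib_left : x ⋏ (y ⋎ z) = x ⋏ y ⋎ x ⋏ z := by
  have h : ∼x ⋎ x ⋏ z = ∼x ⋎ z := by
    simpa only [neg_neg] using or_neg_and (∼x) z
  rw [and_or_and, ← and_neg_or x (y ⋎ x ⋏ z), ← or_assoc, ← or_or_or_left, h,
    or_or_or_left, or_assoc, and_neg_or]

theorem tt_iff : tt ⋏ x ⋎ ∼tt ⋏ ∼x = x := by
  rw [tt_and, neg_tt, ff_and, or_ff]

theorem iff_ff : x ⋏ ff ⋎ ∼x ⋏ ∼ff = ∼x := by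
  simpa only [neg_neg, neg_ff, and_tt, or_ff] using neg_and_or_self (∼x) ff

theorem and_iff : x ⋏ y ⋏ z ⋎ ∼(x ⋏ y) ⋏ ∼z =
    x ⋏ (y ⋏ z ⋎ ∼y ⋏ ∼z) ⋎ ∼x ⋏ ∼z := by
  rw [neg_and, neg_or_and, and_or_distrib_left, and_assoc, or_assoc]

end MSCLAlgebra

namespace ITerm

/-- Provable equality, as a setoid on terms. -/
def derivSetoid : Setoid ITerm where
  r := DerivM
  iseqv := ⟨DerivM.refl, DerivM.symm, DerivM.trans⟩

/-- The Lindenbaum algebra of terms modulo provable equality. -/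
instance : MSCLAlgebra (Quotient derivSetoid) where
  tt := Quotient.mk _ T
  ff := Quotient.mk _ F
  neg := Quotient.map neg fun _ _ h => DerivM.congr_neg h
  and := Quotient.map₂ and fun _ _ h _ _ k => DerivM.congr_and h k
  or := Quotient.map₂ or fun _ _ h _ _ k => DerivM.congr_or h k
  ff_eq := Quotient.sound DerivM.ax_neg
  or_eq := by rintro ⟨x⟩ ⟨y⟩; exact Quotient.sound (DerivM.ax_or x y)
  tt_and := by rintro ⟨x⟩; exact Quotient.sound (DerivM.ax_tand x)
  and_or_self := by rintro ⟨x⟩ ⟨y⟩; exact Quotient.sound (DerivM.ax_abs x y)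
  or_and := by rintro ⟨x⟩ ⟨y⟩ ⟨z⟩; exact Quotient.sound (DerivM.ax_mem x y z)

end ITerm


/-- Every axiom of EqMSCLℓI is derivable from EqMSCL plus the defining equation for ↔❛:
(Or), (Abs), (Assoc), (Tx), (xF), (AndIff). -/
theorem eqmscl_li_derivable_from_eqmscl :
    (∀ x y : ITerm, DerivM (ITerm.or x y)
        (ITerm.neg (ITerm.and (ITerm.neg x) (ITerm.neg y)))) ∧
    (∀ x y : ITerm, DerivM (ITerm.and x (ITerm.or x y)) x) ∧
    (∀ x y z : ITerm, DerivM (ITerm.and (ITerm.and x y) z)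
        (ITerm.and x (ITerm.and y z))) ∧
    (∀ x : ITerm, DerivM (ITerm.iff ITerm.T x) x) ∧
    (∀ x : ITerm, DerivM (ITerm.iff x ITerm.F) (ITerm.neg x)) ∧
    (∀ x y z : ITerm, DerivM (ITerm.iff (ITerm.and x y) z)
        (ITerm.or (ITerm.and x (ITerm.iff y z))
                  (ITerm.and (ITerm.neg x) (ITerm.neg z)))) := by
  refine ⟨DerivM.ax_or, DerivM.ax_abs, fun x y z => ?_, fun x => ?_, fun x => ?_, fun x y z => ?_⟩
  · exact Quotient.exact (MSCLAlgebra.and_assoc (Quotient.mk ITerm.derivSetoid x)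
      (Quotient.mk _ y) (Quotient.mk _ z))
  · exact (DerivM.ax_iffdef _ _).trans
      (Quotient.exact (MSCLAlgebra.tt_iff (Quotient.mk ITerm.derivSetoid x)))
  · exact (DerivM.ax_iffdef _ _).trans
      (Quotient.exact (MSCLAlgebra.iff_ff (Quotient.mk ITerm.derivSetoid x)))
  · refine (DerivM.ax_iffdef _ _).trans (DerivM.trans ?_ (DerivM.congr_or
      (DerivM.congr_and (DerivM.refl x) (DerivM.ax_iffdef y z).symm) (DerivM.refl _)))
    exact Quotient.exact (MSCLAlgebra.and_iff (Quotient.mk ITerm.derivSetoid x)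
      (Quotient.mk _ y) (Quotient.mk _ z))
end
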